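/- Let H : ℝ² → ℝ be H(x, ξ) = ξ²/2 + V(x) with V smooth, V(0) = 0, V' (x) > 0 for x > 0, V'(x) < 0 for x < 0, V'' (0) > 0, and V proper below level a. For 0 < λ < a, let A(λ) be the Lebesgue area of the sublevel set {(x, ξ) : H(x, ξ) < λ} and let T(λ) be the period of the (unique, periodic) integral curve of the Hamiltonian vector field v_H = (∂H/∂ξ) ∂/∂x − (∂H/∂x) ∂/∂ξ on the level set H = λ. Then A is differentiable on (0, a) and A'(λ) = T(λ). -/

import Mathlib

open MeasureTheory Set

lemma inv_lemma (f f' : ℝ → ℝ) (c : ℝ) (hc : 0 < c) (hcont : Continuous f')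
    (hd : ∀ x, HasDerivAt f (f' x) x) (hle : ∀ x, c ≤ f' x) :
    ∃ g : ℝ → ℝ, StrictMono f ∧ StrictMono g ∧ (∀ y, f (g y) = y) ∧ (∀ x, g (f x) = x) ∧
      Continuous g ∧ ∀ y, HasDerivAt g (f' (g y))⁻¹ y := by
  have hmono : StrictMono f := by
    apply strictMono_of_deriv_pos
    intro x
    rw [(hd x).deriv]
    exact lt_of_lt_of_le hc (hle x)
  have hfc : Continuous f := continuous_iff_continuousAt.2 fun x => (hd x).continuousAt
  have hlow := mul_sub_le_image_sub_of_le_deriv (f := f) (fun x => (hd x).differentiableAt)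
    (C := c) (fun x => by rw [(hd x).deriv]; exact hle x)
  have hsurj : Function.Surjective f := by
    apply hfc.surjective
    · apply Filter.tendsto_atTop_mono' _ (f₁ := fun x => c * x + f 0)
      · filter_upwards [Filter.eventually_ge_atTop 0] with x hx
        have := hlow hx
        simp only [sub_zero] at this
        linarith
      · exact Filter.tendsto_atTop_add_const_right _ _
          (Filter.Tendsto.const_mul_atTop hc Filter.tendsto_id)
    · refine Filter.tendsto_atBot_mono' _ (?_ : f ≤ᶠ[Filter.atBot] fun x => c * x + f 0) ?_
      · filter_upwards [Filter.eventually_le_atBot 0] with x hx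
        have := hlow hx
        simp only [zero_sub] at this
        linarith
      · exact Filter.tendsto_atBot_add_const_right _ _
          (Filter.Tendsto.const_mul_atBot hc Filter.tendsto_id)
  let e := hmono.orderIsoOfSurjective f hsurj
  have h1 : ∀ y, f (e.symm y) = y := fun y => e.apply_symm_apply y
  have h2 : ∀ x, e.symm (f x) = x := fun x => e.symm_apply_apply x
  refine ⟨e.symm, hmono, e.symm.strictMono, h1, h2, e.symm.continuous, fun y => ?_⟩
  exact HasDerivAt.of_local_left_inverse e.symm.continuous.continuousAt (hd _)
    (lt_of_lt_of_le hc (hle _)).ne' (Filter.Eventually.of_forall h1)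

lemma sqrt_coord (V : ℝ → ℝ)
    (hV : ContDiff ℝ (⊤ : ℕ∞) V) (hV0 : V 0 = 0)
    (hV'pos : ∀ x > 0, 0 < deriv V x) (hV'neg : ∀ x < 0, deriv V x < 0)
    (hV''0 : 0 < deriv (deriv V) 0) (hVpos : ∀ x, x ≠ 0 → 0 < V x) :
    ∃ s u : ℝ → ℝ, Continuous u ∧ (∀ x, 0 < u x) ∧ (∀ x, HasDerivAt s (u x) x) ∧
      ∀ x, s x ^ 2 = 2 * V x := by
  have hVd : ∀ x, HasDerivAt V (deriv V x) x := fun x =>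
    (hV.differentiable (by simp) x).hasDerivAt
  have hV1 : ContDiff ℝ 1 (deriv V) := by
    have : ContDiff ℝ ((1:WithTop ℕ∞) + 1) V := hV.of_le (by norm_cast)
    exact (contDiff_succ_iff_deriv.1 this).2.2
  have hV'c : Continuous (deriv V) := hV1.continuous
  have hV'0 : deriv V 0 = 0 := by
    have : IsLocalMin V 0 := Filter.Eventually.of_forall fun x => by
      rcases eq_or_ne x 0 with rfl | h
      · exact le_rfl
      · rw [hV0]; exact (hVpos x h).le
    exact this.deriv_eq_zero
  set D := deriv (deriv V) 0 with hD
  have hslope : Filter.Tendsto (fun x => deriv V x / x) (nhdsWithin 0 {0}ᶜ) (nhds D) := by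
    have h := (hV1.differentiable (by simp) 0).hasDerivAt
    rw [hasDerivAt_iff_tendsto_slope] at h
    refine h.congr fun x => ?_
    simp [slope_def_field, hV'0]
  have hquot : Filter.Tendsto (fun x => V x / x ^ 2) (nhdsWithin 0 {0}ᶜ) (nhds (D / 2)) := by
    apply HasDerivAt.lhopital_zero_nhdsNE (f' := deriv V) (g' := fun x => 2 * x)
    · exact Filter.Eventually.of_forall hVd
    · refine Filter.Eventually.of_forall fun x => ?_
      simpa using hasDerivAt_pow 2 x
    · filter_upwards [self_mem_nhdsWithin] with x hx
      simpa using hx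
    · have := hV.continuous.tendsto 0
      rw [hV0] at this
      exact this.mono_left nhdsWithin_le_nhds
    · have : Filter.Tendsto (fun x : ℝ => x ^ 2) (nhds 0) (nhds (0 ^ 2)) :=
        (continuous_pow 2).tendsto 0
      simp only [ne_eq, OfNat.ofNat_ne_zero, not_false_eq_true, zero_pow] at this
      exact this.mono_left nhdsWithin_le_nhds
    · refine (hslope.div_const 2).congr fun x => ?_
      rw [div_div, mul_comm]
  have hg : Filter.Tendsto (fun x => √(2 * (V x / x ^ 2))) (nhdsWithin 0 {0}ᶜ) (nhds √D) := by
    have := (hquot.const_mul 2).sqrt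
    rwa [mul_div_cancel₀ _ (two_ne_zero)] at this
  have hgpos : ∀ x, x ≠ 0 → 0 < √(2 * (V x / x ^ 2)) := fun x hx => by
    have := hVpos x hx
    positivity
  let s : ℝ → ℝ := fun x => x * √(2 * (V x / x ^ 2))
  let u : ℝ → ℝ := fun x => if x = 0 then √D else deriv V x / x / √(2 * (V x / x ^ 2))
  have hu0 : ContinuousAt u 0 := by
    rw [continuousAt_iff_punctured_nhds]
    have h := hslope.div hg (by positivity)
    have h0 : u 0 = D / √D := by simp [u, Real.div_sqrt]
    rw [h0]
    refine h.congr' ?_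
    filter_upwards [self_mem_nhdsWithin] with x hx
    simp only [mem_compl_iff, mem_singleton_iff] at hx
    simp [u, hx]
  have hune : ∀ x, x ≠ 0 → ContinuousAt u x := by
    intro x hx
    have : ContinuousAt (fun x => deriv V x / x / √(2 * (V x / x ^ 2))) x := by
      refine ((hV'c.continuousAt).div continuousAt_id hx).div ?_ (hgpos x hx).ne'
      refine ContinuousAt.sqrt ?_
      exact (hV.continuous.continuousAt.div (by fun_prop) (by simpa using hx)).const_mul 2
    refine this.congr ?_
    filter_upwards [isOpen_ne.mem_nhds hx] with y hy
    simp only [ne_eq, mem_setOf_eq] at hy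
    simp [u, hy]
  have hsd : ∀ x, x ≠ 0 → HasDerivAt s (u x) x := by
    intro x hx
    have h1 : HasDerivAt (fun x => 2 * (V x / x ^ 2)) _ x :=
      (((hVd x).div (hasDerivAt_pow 2 x) (by simpa using hx)).const_mul 2)
    have h2 := (hasDerivAt_id x).mul (h1.sqrt (by have := hVpos x hx; positivity))
    refine h2.congr_deriv ?_
    have hg2 := Real.sq_sqrt (show 0 ≤ 2 * (V x / x ^ 2) by have := hVpos x hx; positivity)
    have hgp := hgpos x hx
    simp only [u, hx, if_false, id]
    set g := √(2 * (V x / x ^ 2)) with hgdef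
    have hVx : V x = g ^ 2 * x ^ 2 / 2 := by rw [hg2]; field_simp
    rw [hVx]
    field_simp
    push_cast
    ring
  refine ⟨s, u, ?_, ?_, ?_, ?_⟩
  · rw [continuous_iff_continuousAt]
    intro x
    rcases eq_or_ne x 0 with rfl | h
    · exact hu0
    · exact hune x h
  · intro x
    simp only [u]
    split_ifs with h
    · positivity
    · refine div_pos ?_ (hgpos x h)
      rcases lt_or_gt_of_ne h with h | h
      · exact div_pos_of_neg_of_neg (hV'neg x h) h
      · exact div_pos (hV'pos x h) h
  · apply hasDerivAt_of_hasDerivAt_of_ne' (x := 0) (fun y hy => hsd y hy) _ hu0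
    rw [continuousAt_iff_punctured_nhds]
    have h : Filter.Tendsto (fun x : ℝ => x) (nhdsWithin 0 {0}ᶜ) (nhds 0) :=
      Filter.tendsto_id.mono_left nhdsWithin_le_nhds
    have := h.mul hg
    simpa [s] using this
  · intro x
    rcases eq_or_ne x 0 with rfl | h
    · simp [s, hV0]
    · simp only [s]
      rw [mul_pow, Real.sq_sqrt (by have := hVpos x h; positivity)]
      field_simp

lemma normal_form (V : ℝ → ℝ) (a b : ℝ)
    (hV : ContDiff ℝ (⊤ : ℕ∞) V) (hV0 : V 0 = 0)
    (hV'pos : ∀ x > 0, 0 < deriv V x) (hV'neg : ∀ x < 0, deriv V x < 0)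
    (hV''0 : 0 < deriv (deriv V) 0)
    (hproper : ∀ lam < a, IsCompact {x : ℝ | V x ≤ lam})
    (hb : 0 < b) (hba : b < a) :
    ∃ (φ w : ℝ → ℝ) (c : ℝ), 0 < c ∧ Continuous w ∧ (∀ x, c ≤ w x) ∧
      (∀ x, HasDerivAt φ (w x) x) ∧ StrictMono φ ∧ Function.Surjective φ ∧
      (∀ x, x ^ 2 ≤ 2 * b → V (φ x) = x ^ 2 / 2) ∧ (∀ x, 2 * b ≤ x ^ 2 → b ≤ V (φ x)) := by
  have hmp : StrictMonoOn V (Ici 0) := by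
    apply strictMonoOn_of_deriv_pos (convex_Ici 0) hV.continuous.continuousOn
    intro x hx
    rw [interior_Ici] at hx
    exact hV'pos x hx
  have hmn : StrictAntiOn V (Iic 0) := by
    apply strictAntiOn_of_deriv_neg (convex_Iic 0) hV.continuous.continuousOn
    intro x hx
    rw [interior_Iic] at hx
    exact hV'neg x hx
  have hVpos : ∀ x, x ≠ 0 → 0 < V x := by
    intro x hx
    rw [← hV0]
    rcases lt_or_gt_of_ne hx with h | h
    · exact hmn h.le (mem_Iic.2 le_rfl) h
    · exact hmp (mem_Ici.2 le_rfl) h.le h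
  obtain ⟨s, u, huc, hup, hsd, hs2⟩ := sqrt_coord V hV hV0 hV'pos hV'neg hV''0 hVpos
  have hsmono : StrictMono s := strictMono_of_deriv_pos fun x => by rw [(hsd x).deriv]; exact hup x
  have hs0 : s 0 = 0 := by have := hs2 0; rw [hV0] at this; simpa using this
  obtain ⟨M, hM⟩ := (hproper b hba).isBounded.exists_norm_le
  have hVM : ∀ x, M < |x| → b < V x := by
    intro x hx
    by_contra! h
    exact absurd (hM x h) (by rw [Real.norm_eq_abs]; linarith)
  have hM' : M < |M| + 1 := by linarith [le_abs_self M]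
  have hM0 : (0:ℝ) ≤ |M| + 1 := by positivity
  obtain ⟨p, hp, hVp⟩ : b ∈ V '' Icc 0 (|M| + 1) := by
    apply intermediate_value_Icc hM0 hV.continuous.continuousOn
    rw [hV0]
    exact ⟨hb.le, (hVM _ (by rwa [abs_of_nonneg hM0])).le⟩
  obtain ⟨q, hq, hVq⟩ : b ∈ V '' Icc (-(|M| + 1)) 0 := by
    apply intermediate_value_Icc' (by linarith) hV.continuous.continuousOn
    rw [hV0]
    exact ⟨hb.le, (hVM _ (by rwa [abs_neg, abs_of_nonneg hM0])).le⟩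
  have hqp : q ≤ p := hq.2.trans hp.1
  let v : ℝ → ℝ := fun x => u (max q (min p x))
  have hclamp : ∀ x, max q (min p x) ∈ Icc q p := fun x =>
    ⟨le_max_left _ _, max_le hqp (min_le_left _ _)⟩
  have hvc : Continuous v := by fun_prop
  obtain ⟨m, hm, hmin⟩ := isCompact_Icc.exists_isMinOn (nonempty_Icc.2 hqp) huc.continuousOn
  obtain ⟨n, hn, hmax⟩ := isCompact_Icc.exists_isMaxOn (nonempty_Icc.2 hqp) huc.continuousOn
  let S : ℝ → ℝ := fun x => ∫ y in (0:ℝ)..x, v y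
  have hSd : ∀ x, HasDerivAt S (v x) x := fun x => (hvc.integral_hasStrictDerivAt 0 x).hasDerivAt
  have hSs : ∀ x ∈ Icc q p, S x = s x := by
    intro x hx
    have : S x = ∫ y in (0:ℝ)..x, u y := by
      apply intervalIntegral.integral_congr
      intro y hy
      have : y ∈ Icc q p := by
        have h0 : (0:ℝ) ∈ Icc q p := ⟨hq.2, hp.1⟩
        exact (ordConnected_Icc.uIcc_subset h0 hx) hy
      simp only [v]
      rw [min_eq_right this.2, max_eq_right this.1]
    rw [this, intervalIntegral.integral_eq_sub_of_hasDerivAt (fun y _ => hsd y)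
      (huc.intervalIntegrable _ _), hs0, sub_zero]
  obtain ⟨φ, hSm, hφm, hSφ, hφS, hφc, hφd⟩ := inv_lemma S v (u m) (hup m) hvc hSd
    (fun x => hmin (hclamp x))
  have hvpos : ∀ x, 0 < v x := fun x => hup _
  have key : ∀ x, φ x ∈ Icc q p → V (φ x) = x ^ 2 / 2 := by
    intro x hx
    have := hs2 (φ x)
    rw [← hSs _ hx, hSφ] at this
    linarith
  have hSp : S p = √(2 * b) := by
    rw [hSs p ⟨hqp, le_rfl⟩, ← hVp, ← hs2, Real.sqrt_sq]
    rw [← hs0]; exact hsmono.monotone hp.1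
  have hSq : S q = -√(2 * b) := by
    rw [hSs q ⟨le_rfl, hqp⟩, ← hVq, ← hs2, ← neg_sq, Real.sqrt_sq, neg_neg]
    have := hsmono.monotone hq.2
    rw [hs0] at this
    linarith
  refine ⟨φ, fun y => (v (φ y))⁻¹, (u n)⁻¹, inv_pos.2 (hup n), ?_, ?_, hφd, hφm,
    fun x => ⟨S x, hφS x⟩, ?_, ?_⟩
  · exact (hvc.comp hφc).inv₀ fun x => (hvpos _).ne'
  · intro x
    exact inv_anti₀ (hvpos _) (hmax (hclamp (φ x)))
  · intro x hx
    apply key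
    have := Real.abs_le_sqrt hx
    rw [abs_le] at this
    constructor
    · rw [← hSm.le_iff_le, hSq, hSφ]; exact this.1
    · rw [← hSm.le_iff_le, hSp, hSφ]; exact this.2
  · intro x hx
    have := Real.sqrt_le_sqrt hx
    rw [Real.sqrt_sq_eq_abs, le_abs] at this
    rcases this with h | h
    · rw [← hSp] at h
      have : p ≤ φ x := by rw [← hSm.le_iff_le, hSφ]; exact h
      rw [← hVp]
      exact hmp.monotoneOn hp.1 (hp.1.trans this) this
    · have : φ x ≤ q := by rw [← hSm.le_iff_le, hSφ, hSq]; linarith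
      rw [← hVq]
      exact hmn.antitoneOn (this.trans hq.2) hq.2 this

lemma area_formula (V : ℝ → ℝ) (hV : Continuous V) (b : ℝ) (φ w : ℝ → ℝ) (c : ℝ) (hc : 0 < c)
    (hw : Continuous w) (hcw : ∀ x, c ≤ w x) (hφd : ∀ x, HasDerivAt φ (w x) x)
    (hφm : StrictMono φ) (hφs : Function.Surjective φ)
    (h1 : ∀ x, x ^ 2 ≤ 2 * b → V (φ x) = x ^ 2 / 2) (h2 : ∀ x, 2 * b ≤ x ^ 2 → b ≤ V (φ x))
    (lam : ℝ) (hl0 : 0 < lam) (hlb : lam < b) :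
    (volume {p : ℝ × ℝ | p.2 ^ 2 / 2 + V p.1 < lam}).toReal =
      ∫ r in (0:ℝ)..√(2 * lam), r * ∫ θ in (-Real.pi)..Real.pi, w (r * Real.cos θ) := by
  have hwpos : ∀ x, 0 < w x := fun x => hc.trans_le (hcw x)
  set F : ℝ → ℝ := fun r => ∫ θ in (-Real.pi)..Real.pi, w (r * Real.cos θ) with hF
  have hFc : Continuous F := by
    apply intervalIntegral.continuous_parametric_intervalIntegral_of_continuous'
    fun_prop
  have hpi : -Real.pi ≤ Real.pi := by linarith [Real.pi_pos]
  have hFpos : ∀ r, 0 ≤ F r := fun r =>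
    intervalIntegral.integral_nonneg hpi fun θ _ => (hwpos _).le
  have hiff : ∀ x y : ℝ, y ^ 2 / 2 + V (φ x) < lam ↔ x ^ 2 + y ^ 2 < 2 * lam := by
    intro x y
    rcases le_total (x ^ 2) (2 * b) with h | h
    · rw [h1 x h]
      constructor <;> intro h <;> linarith
    · have := h2 x h
      constructor <;> intro h' <;> nlinarith [sq_nonneg y]
  have hmeas : MeasurableSet {p : ℝ × ℝ | p.2 ^ 2 / 2 + V p.1 < lam} :=
    (isOpen_lt (by fun_prop) continuous_const).measurableSet
  have hmeas2 : MeasurableSet {p : ℝ × ℝ | p.1 ^ 2 + p.2 ^ 2 < 2 * lam} :=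
    (isOpen_lt (by fun_prop) continuous_const).measurableSet
  let f : ℝ × ℝ → ENNReal := fun p =>
    {p : ℝ × ℝ | p.1 ^ 2 + p.2 ^ 2 < 2 * lam}.indicator (fun p => ENNReal.ofReal (w p.1)) p
  have hfm : Measurable f := by
    apply Measurable.indicator _ hmeas2
    exact ENNReal.measurable_ofReal.comp (hw.measurable.comp measurable_fst)
  have step1 : volume {p : ℝ × ℝ | p.2 ^ 2 / 2 + V p.1 < lam} = ∫⁻ p, f p := by
    rw [Measure.volume_eq_prod, Measure.prod_apply hmeas, lintegral_prod _ hfm.aemeasurable]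
    have := lintegral_image_eq_lintegral_abs_deriv_mul (s := univ) MeasurableSet.univ
      (fun x _ => (hφd x).hasDerivWithinAt) hφm.injective.injOn
      (fun x => volume (Prod.mk x ⁻¹' {p : ℝ × ℝ | p.2 ^ 2 / 2 + V p.1 < lam}))
    rw [image_univ, hφs.range_eq, Measure.restrict_univ] at this
    rw [this]
    refine lintegral_congr fun x => ?_
    have hset : (Prod.mk (φ x) ⁻¹' {p : ℝ × ℝ | p.2 ^ 2 / 2 + V p.1 < lam}) =
      {y : ℝ | x ^ 2 + y ^ 2 < 2 * lam} := by
      ext y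
      simp only [mem_preimage, mem_setOf_eq]
      exact hiff x y
    have hms : MeasurableSet {y : ℝ | x ^ 2 + y ^ 2 < 2 * lam} :=
      (isOpen_lt (by fun_prop) continuous_const).measurableSet
    rw [hset, abs_of_pos (hwpos x), ← lintegral_indicator_const hms]
    rfl
  have step2 : ∫⁻ p, f p = ∫⁻ r in Ioi (0:ℝ), ∫⁻ θ in Ioo (-Real.pi) Real.pi,
      ENNReal.ofReal r * f (r * Real.cos θ, r * Real.sin θ) := by
    rw [← lintegral_comp_polarCoord_symm, polarCoord_target, Measure.volume_eq_prod,
      ← Measure.prod_restrict, lintegral_prod]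
    · simp only [polarCoord_symm_apply, smul_eq_mul]
    · apply Measurable.aemeasurable
      simp only [polarCoord_symm_apply, smul_eq_mul]
      refine Measurable.mul (by fun_prop) (hfm.comp (by fun_prop))
  have step3 : ∀ r ∈ Ioi (0:ℝ), ∫⁻ θ in Ioo (-Real.pi) Real.pi,
      ENNReal.ofReal r * f (r * Real.cos θ, r * Real.sin θ) =
      (Ioo 0 √(2 * lam)).indicator (fun r => ENNReal.ofReal (r * F r)) r := by
    intro r hr
    have hr0 : 0 < r := hr
    have hmem : ∀ θ : ℝ, ((r * Real.cos θ, r * Real.sin θ) ∈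
        {p : ℝ × ℝ | p.1 ^ 2 + p.2 ^ 2 < 2 * lam}) ↔ r ∈ Ioo 0 √(2 * lam) := by
      intro θ
      have : (r * Real.cos θ) ^ 2 + (r * Real.sin θ) ^ 2 = r ^ 2 := by
        have := Real.sin_sq_add_cos_sq θ
        linear_combination r ^ 2 * this
      simp only [mem_setOf_eq, this, mem_Ioo, hr0, true_and]
      rw [Real.lt_sqrt hr0.le]
    by_cases h : r ∈ Ioo 0 √(2 * lam)
    · have hf : ∀ θ, f (r * Real.cos θ, r * Real.sin θ) = ENNReal.ofReal (w (r * Real.cos θ)) :=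
        fun θ => indicator_of_mem ((hmem θ).2 h) _
      simp only [hf]
      rw [indicator_of_mem h, lintegral_const_mul _ (by fun_prop),
        ENNReal.ofReal_mul hr0.le, hF]
      congr 1
      simp only
      rw [intervalIntegral.integral_of_le hpi, integral_Ioc_eq_integral_Ioo,
        ofReal_integral_eq_lintegral_ofReal]
      · have : Continuous (fun θ => w (r * Real.cos θ)) := by fun_prop
        exact (this.integrableOn_Icc).mono_set Ioo_subset_Icc_self
      · exact Filter.Eventually.of_forall fun θ => (hwpos _).le
    · have hf : ∀ θ, f (r * Real.cos θ, r * Real.sin θ) = 0 :=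
        fun θ => indicator_of_notMem (fun h' => h ((hmem θ).1 h')) _
      simp only [hf]
      rw [indicator_of_notMem h]
      simp
  rw [step1, step2, setLIntegral_congr_fun measurableSet_Ioi step3,
    setLIntegral_indicator measurableSet_Ioo, inter_eq_left.2 Ioo_subset_Ioi_self,
    intervalIntegral.integral_of_le (Real.sqrt_nonneg _), integral_Ioc_eq_integral_Ioo,
    ← ofReal_integral_eq_lintegral_ofReal, ENNReal.toReal_ofReal]
  · exact setIntegral_nonneg measurableSet_Ioo fun r hr => mul_nonneg hr.1.le (hFpos r)
  · have : Continuous (fun r => r * F r) := by fun_prop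
    exact (this.integrableOn_Icc).mono_set Ioo_subset_Icc_self
  · filter_upwards [ae_restrict_mem measurableSet_Ioo] with r hr
    exact mul_nonneg hr.1.le (hFpos r)

lemma period_formula (V : ℝ → ℝ) (hV : ContDiff ℝ (⊤ : ℕ∞) V) (b : ℝ)
    (φ w : ℝ → ℝ) (c : ℝ) (hc : 0 < c)
    (hw : Continuous w) (hcw : ∀ x, c ≤ w x) (hφd : ∀ x, HasDerivAt φ (w x) x)
    (hφm : StrictMono φ) (hφs : Function.Surjective φ)
    (h1 : ∀ x, x ^ 2 ≤ 2 * b → V (φ x) = x ^ 2 / 2) (h2 : ∀ x, 2 * b ≤ x ^ 2 → b ≤ V (φ x))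
    (lam : ℝ) (hl0 : 0 < lam) (hlb : lam < b) (hcpt : IsCompact {x : ℝ | V x ≤ lam})
    (γ : ℝ → ℝ × ℝ) (T : ℝ)
    (hγlevel : ∀ t : ℝ, (γ t).2 ^ 2 / 2 + V (γ t).1 = lam)
    (hγode : ∀ t : ℝ, HasDerivAt γ ((γ t).2, - deriv V (γ t).1) t)
    (hTpos : 0 < T) (hTper : ∀ t : ℝ, γ (t + T) = γ t)
    (hTmin : ∀ t ∈ Ioo 0 T, γ t ≠ γ 0) :
    T = ∫ θ in (-Real.pi)..Real.pi, w (√(2 * lam) * Real.cos θ) := by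
  have hwpos : ∀ x, 0 < w x := fun x => hc.trans_le (hcw x)
  set R := √(2 * lam) with hR
  have hR2 : R ^ 2 = 2 * lam := Real.sq_sqrt (by linarith)
  have hRpos : 0 < R := Real.sqrt_pos.2 (by linarith)
  have hVd : ∀ x, HasDerivAt V (deriv V x) x := fun x =>
    (hV.differentiable (by simp) x).hasDerivAt
  have hV1 : ContDiff ℝ 1 (deriv V) := by
    have : ContDiff ℝ ((1:WithTop ℕ∞) + 1) V := hV.of_le (by norm_cast)
    exact (contDiff_succ_iff_deriv.1 this).2.2
  set F := ∫ θ in (-Real.pi)..Real.pi, w (R * Real.cos θ) with hF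
  have hgc : Continuous (fun θ => w (R * Real.cos θ)) := by fun_prop
  have hFpos : 0 < F := by
    apply intervalIntegral.intervalIntegral_pos_of_pos (hgc.intervalIntegrable _ _)
      (fun θ => hwpos _)
    linarith [Real.pi_pos]
  let G : ℝ → ℝ := fun θ => ∫ u in (0:ℝ)..θ, w (R * Real.cos u)
  have hGd : ∀ θ, HasDerivAt G (w (R * Real.cos θ)) θ := fun θ =>
    (hgc.integral_hasStrictDerivAt 0 θ).hasDerivAt
  have hGper : ∀ θ, G (θ + 2 * Real.pi) = G θ + F := by
    intro θ
    have hp : Function.Periodic (fun θ => w (R * Real.cos θ)) (2 * Real.pi) := by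
      intro x; simp
    have h := hp.intervalIntegral_add_eq θ (-Real.pi)
    rw [show -Real.pi + 2 * Real.pi = Real.pi by ring] at h
    simp only [G]
    rw [hF, ← h]
    exact (intervalIntegral.integral_add_adjacent_intervals (hgc.intervalIntegrable _ _)
      (hgc.intervalIntegrable _ _)).symm
  have hGnat : ∀ (k : ℕ) θ, G (θ + 2 * Real.pi * k) = G θ + k * F := by
    intro k
    induction k with
    | zero => intro θ; simp
    | succ k ih =>
      intro θ
      have := hGper (θ + 2 * Real.pi * k)
      rw [ih] at this
      push_cast
      rw [show θ + 2 * Real.pi * (k + 1) = θ + 2 * Real.pi * k + 2 * Real.pi by ring, this]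
      ring
  obtain ⟨Θ, hGm, hΘm, hGΘ, hΘG, hΘc, hΘd⟩ := inv_lemma G _ c hc hgc hGd (fun θ => hcw _)
  have hV' : ∀ σ, σ ^ 2 < 2 * b → deriv V (φ σ) * w σ = σ := by
    intro σ hσ
    have e1 : HasDerivAt (fun x => V (φ x)) (deriv V (φ σ) * w σ) σ := (hVd (φ σ)).comp σ (hφd σ)
    have e2 : HasDerivAt (fun x : ℝ => x ^ 2 / 2) σ σ := by
      have := (hasDerivAt_pow 2 σ).div_const 2
      simpa using this
    have e3 : (fun x => V (φ x)) =ᶠ[nhds σ] fun x => x ^ 2 / 2 := by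
      have : {x : ℝ | x ^ 2 < 2 * b} ∈ nhds σ :=
        (isOpen_lt (by fun_prop) continuous_const).mem_nhds hσ
      filter_upwards [this] with x hx
      exact h1 x (le_of_lt hx)
    exact e1.unique (e2.congr_of_eventuallyEq e3)
  have hcosle : ∀ θ, (R * Real.cos θ) ^ 2 ≤ 2 * lam := by
    intro θ
    rw [mul_pow, hR2]
    have := Real.cos_sq_le_one θ
    nlinarith
  -- initial angle
  obtain ⟨σ0, hσ0⟩ := hφs (γ 0).1
  have hlev0 := hγlevel 0
  have hσ0b : σ0 ^ 2 < 2 * b := by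
    by_contra! h
    have := h2 σ0 h
    rw [hσ0] at this
    nlinarith [sq_nonneg (γ 0).2]
  have hcirc : σ0 ^ 2 + (γ 0).2 ^ 2 = R ^ 2 := by
    rw [← hσ0, h1 σ0 hσ0b.le] at hlev0
    rw [hR2]; linarith
  obtain ⟨θ0, hcos0, hsin0⟩ : ∃ θ0, R * Real.cos θ0 = σ0 ∧ R * Real.sin θ0 = (γ 0).2 := by
    let z : ℂ := ⟨σ0, (γ 0).2⟩
    have hz : ‖z‖ = R := by
      rw [Complex.norm_def, Complex.normSq_mk, ← sq, ← sq, hcirc, Real.sqrt_sq hRpos.le]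
    refine ⟨z.arg, ?_, ?_⟩
    · rw [← hz, Complex.norm_mul_cos_arg]
    · rw [← hz, Complex.norm_mul_sin_arg]
  set d := G θ0 with hd
  let β : ℝ → ℝ × ℝ := fun t => (φ (R * Real.cos (Θ (d - t))), R * Real.sin (Θ (d - t)))
  have hβlevel : ∀ t, (β t).2 ^ 2 / 2 + V (β t).1 = lam := by
    intro t
    simp only [β]
    rw [h1 _ ((hcosle _).trans (by linarith))]
    have := Real.sin_sq_add_cos_sq (Θ (d - t))
    linear_combination R ^ 2 / 2 * this + hR2 / 2
  have hβode : ∀ t, HasDerivAt β ((β t).2, - deriv V (β t).1) t := by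
    intro t
    have e0 : HasDerivAt (fun t => Θ (d - t)) ((w (R * Real.cos (Θ (d - t))))⁻¹ * (-1)) t :=
      (hΘd (d - t)).comp t ((hasDerivAt_id t).const_sub d)
    have e1 := (hφd (R * Real.cos (Θ (d - t)))).comp t (e0.cos.const_mul R)
    have e2 := e0.sin.const_mul R
    refine (e1.prodMk e2).congr_deriv ?_
    have hv := hV' (R * Real.cos (Θ (d - t))) ((hcosle _).trans_lt (by linarith))
    have hwp := hwpos (R * Real.cos (Θ (d - t)))
    simp only [β]
    ext
    · simp only
      field_simp
    · simp only
      field_simp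
      linarith
  obtain ⟨M, hM⟩ := hcpt.isBounded.exists_norm_le
  let K : Set (ℝ × ℝ) := Icc (-M) M ×ˢ Icc (-R) R
  have hKmem : ∀ p : ℝ × ℝ, p.2 ^ 2 / 2 + V p.1 = lam → 0 ≤ V p.1 → p ∈ K := by
    intro p hp hp0
    refine ⟨abs_le.1 (hM p.1 ?_), abs_le.1 (Real.abs_le_sqrt ?_)⟩
    · simp only [mem_setOf_eq]; nlinarith [sq_nonneg p.2]
    · linarith
  have hVnn : ∀ x, 0 ≤ V x := by
    intro x
    obtain ⟨σ, rfl⟩ := hφs x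
    rcases le_total (σ ^ 2) (2 * b) with h | h
    · rw [h1 σ h]; positivity
    · linarith [h2 σ h]
  have hK : ∃ L, LipschitzOnWith L (fun p : ℝ × ℝ => (p.2, - deriv V p.1)) K := by
    apply ContDiffOn.exists_lipschitzOnWith (n := 1) _ one_ne_zero
      ((convex_Icc _ _).prod (convex_Icc _ _)) (isCompact_Icc.prod isCompact_Icc)
    exact (contDiff_snd.prodMk (hV1.comp contDiff_fst).neg).contDiffOn
  obtain ⟨L, hL⟩ := hK
  have hβ0 : γ 0 = β 0 := by
    simp only [β, sub_zero, hd, hΘG]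
    ext
    · simp only [hcos0, hσ0]
    · simp only [hsin0]
  have hγβ : γ = β :=
    ODE_solution_unique_univ (v := fun _ p => (p.2, - deriv V p.1)) (s := fun _ => K) (t₀ := 0)
      (fun _ => hL) (fun t => ⟨hγode t, hKmem _ (hγlevel t) (hVnn _)⟩)
      (fun t => ⟨hβode t, hKmem _ (hβlevel t) (hVnn _)⟩) hβ0
  -- T is a multiple of F
  have hTF : F ≤ T := by
    have hT0 := hTper 0
    rw [zero_add, hγβ] at hT0
    simp only [β, sub_zero, Prod.mk.injEq] at hT0
    have hcos : Real.cos (Θ d) = Real.cos (Θ (d - T)) :=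
      mul_left_cancel₀ hRpos.ne' (hφm.injective hT0.1.symm)
    have hsin : Real.sin (Θ d) = Real.sin (Θ (d - T)) :=
      mul_left_cancel₀ hRpos.ne' hT0.2.symm
    obtain ⟨k, hk⟩ := Real.Angle.angle_eq_iff_two_pi_dvd_sub.1 (Real.Angle.cos_sin_inj hcos hsin)
    have hlt : Θ (d - T) < Θ d := hΘm (by linarith)
    have hkpos : 0 < k := by
      have : 0 < 2 * Real.pi * (k:ℝ) := by linarith
      have h3 : (0:ℝ) < k := by
        by_contra! h
        nlinarith [Real.pi_pos]
      exact_mod_cast h3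
    obtain ⟨n, rfl⟩ := Int.eq_ofNat_of_zero_le hkpos.le
    have hn : 1 ≤ n := by omega
    have h4 := hGnat n (Θ (d - T))
    have h5 : Θ (d - T) + 2 * Real.pi * (n:ℝ) = Θ d := by
      have : (((n:ℕ):ℤ):ℝ) = (n:ℝ) := by norm_cast
      rw [← this, ← hk]; ring
    rw [h5, hGΘ, hGΘ] at h4
    have : (1:ℝ) ≤ n := by exact_mod_cast hn
    nlinarith
  by_contra hne
  have hlt : F < T := lt_of_le_of_ne hTF (Ne.symm hne)
  apply hTmin F ⟨hFpos, hlt⟩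
  have h6 : Θ d = Θ (d - F) + 2 * Real.pi := by
    apply hGm.injective
    rw [hGper, hGΘ, hGΘ]; ring
  rw [hγβ]
  simp only [β, sub_zero, h6, Real.cos_add_two_pi, Real.sin_add_two_pi]



/-- The area–period relation: for a single-well Hamiltonian `H(x,ξ) = ξ²/2 + V(x)`,
the area `A(λ)` of the sublevel set `{H < λ}` satisfies `A'(λ) = T(λ)`,
the period of the periodic orbit on the level set `{H = λ}`. -/
theorem stmt4 (V : ℝ → ℝ) (a : ℝ) (ha : 0 < a)
    (hV : ContDiff ℝ (⊤ : ℕ∞) V) (hV0 : V 0 = 0)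
    (hV'pos : ∀ x > 0, 0 < deriv V x) (hV'neg : ∀ x < 0, deriv V x < 0)
    (hV''0 : 0 < deriv (deriv V) 0)
    (hproper : ∀ lam < a, IsCompact {x : ℝ | V x ≤ lam})
    (A T : ℝ → ℝ)
    (hA : ∀ lam, A lam = (volume {p : ℝ × ℝ | p.2 ^ 2 / 2 + V p.1 < lam}).toReal)
    (γ : ℝ → ℝ → ℝ × ℝ)
    -- γ lam is an integral curve of the Hamiltonian vector field on the level set H = lam
    (hγlevel : ∀ lam ∈ Ioo 0 a, ∀ t : ℝ, (γ lam t).2 ^ 2 / 2 + V (γ lam t).1 = lam)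
    (hγode : ∀ lam ∈ Ioo 0 a, ∀ t : ℝ,
      HasDerivAt (γ lam) ((γ lam t).2, - deriv V (γ lam t).1) t)
    -- T lam is the (minimal positive) period of this integral curve
    (hTpos : ∀ lam ∈ Ioo 0 a, 0 < T lam)
    (hTper : ∀ lam ∈ Ioo 0 a, ∀ t : ℝ, γ lam (t + T lam) = γ lam t)
    (hTmin : ∀ lam ∈ Ioo 0 a, ∀ t ∈ Ioo 0 (T lam), γ lam t ≠ γ lam 0) :
    ∀ lam ∈ Ioo 0 a, HasDerivAt A (T lam) lam := by
  intro lam hlam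
  obtain ⟨b, hlb, hba⟩ := exists_between hlam.2
  have hl0 := hlam.1
  obtain ⟨φ, w, c, hc, hw, hcw, hφd, hφm, hφs, h1, h2⟩ :=
    normal_form V a b hV hV0 hV'pos hV'neg hV''0 hproper (hl0.trans hlb) hba
  have hT := period_formula V hV b φ w c hc hw hcw hφd hφm hφs h1 h2 lam hl0 hlb
    (hproper lam hlam.2) (γ lam) (T lam) (hγlevel lam hlam) (hγode lam hlam) (hTpos lam hlam)
    (hTper lam hlam) (hTmin lam hlam)
  have hFc : Continuous fun r => ∫ θ in (-Real.pi)..Real.pi, w (r * Real.cos θ) := by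
    apply intervalIntegral.continuous_parametric_intervalIntegral_of_continuous'
    fun_prop
  have hBc : Continuous fun r => r * ∫ θ in (-Real.pi)..Real.pi, w (r * Real.cos θ) :=
    continuous_id.mul hFc
  have hA' : A =ᶠ[nhds lam] fun μ => ∫ r in (0:ℝ)..√(2 * μ),
      r * ∫ θ in (-Real.pi)..Real.pi, w (r * Real.cos θ) := by
    filter_upwards [Ioo_mem_nhds hl0 hlb] with μ hμ
    rw [hA, area_formula V hV.continuous b φ w c hc hw hcw hφd hφm hφs h1 h2 μ hμ.1 hμ.2]
  have hRpos : 0 < √(2 * lam) := Real.sqrt_pos.2 (by linarith)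
  have hs : HasDerivAt (fun μ : ℝ => √(2 * μ)) (2 * 1 / (2 * √(2 * lam))) lam :=
    ((hasDerivAt_id lam).const_mul 2).sqrt (by simp only [id]; linarith)
  have hd := ((hBc.integral_hasStrictDerivAt 0 (√(2 * lam))).hasDerivAt).comp lam hs
  refine (hd.congr_of_eventuallyEq hA').congr_deriv ?_
  rw [hT]
  field_simp
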